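/- arXiv:2203.16438 — 4 statements merged into one kernel-verified Lean document; each statement's English description precedes it below -/
import Mathlib

section
/- Theorem 1(i) (boundedness of the Heavy Ball tuner): if 0 < β < 2 and 0 < γ ≤ β(2−β)/8, then for every k ≥ 0, ‖ϑ_k − θ*‖² ≤ γ V_0 and ‖θ_k − ϑ_k‖² ≤ γ V_0; hence the sequences (ϑ_k − θ*) and (θ_k − ϑ_k) are bounded (belong to ℓ∞). -/
open scoped RealInnerProductSpace

/-- One normalized gradient step of the Heavy Ball tuner, written in terms of the errors
`a = ϑ - θ*` and `d = θ - ϑ`, does not increase `‖a‖ ^ 2 + ‖d‖ ^ 2`. -/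
theorem heavyBall_step_norm_sq_le {E : Type*} [NormedAddCommGroup E] [InnerProductSpace ℝ E]
    {β γ : ℝ} (hγ0 : 0 < γ) (hγ : γ ≤ β * (2 - β) / 8) (φ a d : E) :
    ‖a - ((γ / (1 + ‖φ‖ ^ 2)) * ⟪φ, a + (1 - β) • d⟫) • φ‖ ^ 2 +
      ‖(1 - β) • d + ((γ / (1 + ‖φ‖ ^ 2)) * ⟪φ, a + (1 - β) • d⟫) • φ‖ ^ 2 ≤
      ‖a‖ ^ 2 + ‖d‖ ^ 2 := by
  set c := γ / (1 + ‖φ‖ ^ 2) with hc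
  set e := ⟪φ, a + (1 - β) • d⟫ with he
  have hc0 : 0 ≤ c := by positivity
  have hcs : c * ‖φ‖ ^ 2 ≤ γ := by
    rw [hc, div_mul_eq_mul_div, div_le_iff₀ (by positivity)]
    nlinarith
  have he' : ⟪φ, a⟫ = e - (1 - β) * ⟪φ, d⟫ := by
    rw [he, inner_add_right, real_inner_smul_right]
    ring
  have ha : ‖a - (c * e) • φ‖ ^ 2 =
      ‖a‖ ^ 2 - 2 * (c * e) * ⟪φ, a⟫ + (c * e) ^ 2 * ‖φ‖ ^ 2 := by
    rw [norm_sub_sq_real, real_inner_smul_right, norm_smul, mul_pow, Real.norm_eq_abs, sq_abs,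
      real_inner_comm]
    ring
  have hd : ‖(1 - β) • d + (c * e) • φ‖ ^ 2 = (1 - β) ^ 2 * ‖d‖ ^ 2 +
      2 * (c * e) * ((1 - β) * ⟪φ, d⟫) + (c * e) ^ 2 * ‖φ‖ ^ 2 := by
    rw [norm_add_sq_real, real_inner_smul_right, real_inner_smul_left, norm_smul, norm_smul,
      mul_pow, mul_pow, Real.norm_eq_abs, Real.norm_eq_abs, sq_abs, sq_abs, real_inner_comm]
    ring
  have hp : ⟪φ, d⟫ ^ 2 ≤ ‖φ‖ ^ 2 * ‖d‖ ^ 2 := by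
    rw [← mul_pow]
    exact sq_le_sq.mpr ((abs_real_inner_le_norm φ d).trans (le_abs_self _))
  have hq : c * ((1 - β) * ⟪φ, d⟫) ^ 2 ≤ γ * ‖d‖ ^ 2 :=
    calc c * ((1 - β) * ⟪φ, d⟫) ^ 2 = (1 - β) ^ 2 * (c * ⟪φ, d⟫ ^ 2) := by ring
      _ ≤ 1 * (c * ⟪φ, d⟫ ^ 2) := by gcongr; nlinarith
      _ ≤ c * (‖φ‖ ^ 2 * ‖d‖ ^ 2) := by rw [one_mul]; gcongr
      _ = c * ‖φ‖ ^ 2 * ‖d‖ ^ 2 := by ring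
      _ ≤ γ * ‖d‖ ^ 2 := by gcongr
  have hγ8 : γ ≤ 1 / 8 := by nlinarith [sq_nonneg (1 - β)]
  have hce : (c * e) ^ 2 * ‖φ‖ ^ 2 ≤ 1 / 8 * (c * e ^ 2) :=
    calc (c * e) ^ 2 * ‖φ‖ ^ 2 = c * ‖φ‖ ^ 2 * (c * e ^ 2) := by ring
      _ ≤ 1 / 8 * (c * e ^ 2) := by gcongr; exact hcs.trans hγ8
  have hyoung : 0 ≤ c * (e - 2 * ((1 - β) * ⟪φ, d⟫)) ^ 2 := by positivity
  have hce0 : 0 ≤ c * e ^ 2 := by positivity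
  have hdamp : 8 * γ * ‖d‖ ^ 2 ≤ β * (2 - β) * ‖d‖ ^ 2 :=
    mul_le_mul_of_nonneg_right (by linarith) (by positivity)
  have hD : 0 ≤ γ * ‖d‖ ^ 2 := by positivity
  rw [ha, hd, he']
  linarith

theorem hb_boundedness
    (n : ℕ) (hn : 1 ≤ n)
    (θstar : EuclideanSpace ℝ (Fin n))
    (φ θ ϑ : ℕ → EuclideanSpace ℝ (Fin n))
    (β γ : ℝ) (hβ0 : 0 < β) (hβ2 : β < 2)
    (hγ0 : 0 < γ) (hγ : γ ≤ β * (2 - β) / 8)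
    (hθ : ∀ k, θ (k + 1) = θ k - β • (θ k - ϑ k))
    (hϑ : ∀ k, ϑ (k + 1) =
      ϑ k - ((γ / (1 + ‖φ k‖ ^ 2)) * ⟪φ k, θ (k + 1) - θstar⟫) • φ k)
    (V : ℕ → ℝ)
    (hV : ∀ k, V k = (1 / γ) * ‖ϑ k - θstar‖ ^ 2 + (1 / γ) * ‖θ k - ϑ k‖ ^ 2)
    :
    (∀ k, ‖ϑ k - θstar‖ ^ 2 ≤ γ * V 0 ∧ ‖θ k - ϑ k‖ ^ 2 ≤ γ * V 0) ∧
    (∃ C : ℝ, ∀ k, ‖ϑ k - θstar‖ ≤ C ∧ ‖θ k - ϑ k‖ ≤ C) := by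
  have hstep : ∀ k, ‖ϑ (k + 1) - θstar‖ ^ 2 + ‖θ (k + 1) - ϑ (k + 1)‖ ^ 2 ≤
      ‖ϑ k - θstar‖ ^ 2 + ‖θ k - ϑ k‖ ^ 2 := by
    intro k
    have h := heavyBall_step_norm_sq_le hγ0 hγ (φ k) (ϑ k - θstar) (θ k - ϑ k)
    have he : θ (k + 1) - θstar = (ϑ k - θstar) + (1 - β) • (θ k - ϑ k) := by
      rw [hθ k]
      module
    rw [← he] at h
    have ha : ϑ (k + 1) - θstar = ϑ k - θstar -
        ((γ / (1 + ‖φ k‖ ^ 2)) * ⟪φ k, θ (k + 1) - θstar⟫) • φ k := by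
      rw [hϑ k]
      abel
    have hd : θ (k + 1) - ϑ (k + 1) = (1 - β) • (θ k - ϑ k) +
        ((γ / (1 + ‖φ k‖ ^ 2)) * ⟪φ k, θ (k + 1) - θstar⟫) • φ k := by
      rw [hϑ k, sub_sub_eq_add_sub, add_sub_right_comm, add_left_inj, hθ k]
      module
    rwa [ha, hd]
  have hanti : Antitone fun k ↦ ‖ϑ k - θstar‖ ^ 2 + ‖θ k - ϑ k‖ ^ 2 :=
    antitone_nat_of_succ_le hstep
  have hV0 : γ * V 0 = ‖ϑ 0 - θstar‖ ^ 2 + ‖θ 0 - ϑ 0‖ ^ 2 := by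
    rw [hV 0]
    field_simp
  have hbound : ∀ k, ‖ϑ k - θstar‖ ^ 2 ≤ γ * V 0 ∧ ‖θ k - ϑ k‖ ^ 2 ≤ γ * V 0 := by
    intro k
    have h : ‖ϑ k - θstar‖ ^ 2 + ‖θ k - ϑ k‖ ^ 2 ≤ γ * V 0 := hV0 ▸ hanti (Nat.zero_le k)
    exact ⟨by linarith [sq_nonneg ‖θ k - ϑ k‖], by linarith [sq_nonneg ‖ϑ k - θstar‖]⟩
  exact ⟨hbound, √(γ * V 0), fun k ↦
    ⟨Real.le_sqrt_of_sq_le (hbound k).1, Real.le_sqrt_of_sq_le (hbound k).2⟩⟩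
end

section
/- Heavy Ball one-window contraction: suppose 0 < β < 2, 0 < γ ≤ β(2−β)/8, the regressor is PE with level ε over window ΔT, ‖φ_k‖ ≤ Φ for all k, 0 < λ < 1, η > 0 satisfies γη|1−β| < ε₁ with ε₁ = ε/√(1+Φ²). Let μ = min{μ₁, μ₂, μ₃} where μ₁ = (11/8)λγη²/ΔT, μ₂ = (21/32)·ΔT·(ε₁ − γη|1−β|)²·λγ/(1+γΔT)², μ₃ = (11/8)(1−λ)γ/ΔT. Then for every k ≥ ΔT, V_k ≤ (1 − μ) V_{k−ΔT}. -/
open scoped RealInnerProductSpace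

section HeavyBall

variable {E : Type*} [NormedAddCommGroup E] [InnerProductSpace ℝ E]

/-- A heavy-ball step in the coordinates `x = ϑ - θ*`, `y = θ - ϑ` decreases `‖x‖² + ‖y‖²` by a
multiple of the squared normalized error plus a multiple of `‖y‖²`. -/
lemma heavyBall_step_decrease (φ x y : E) {β γ : ℝ} (hγ0 : 0 < γ)
    (hγ : γ ≤ β * (2 - β) / 8) {s : ℝ} (hs : s = ⟪φ, x + (1 - β) • y⟫) :
    ‖x - ((γ / (1 + ‖φ‖ ^ 2)) * s) • φ‖ ^ 2
        + ‖(1 - β) • y + ((γ / (1 + ‖φ‖ ^ 2)) * s) • φ‖ ^ 2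
      ≤ ‖x‖ ^ 2 + ‖y‖ ^ 2
        - γ * (11 / 8 * (|s| / √(1 + ‖φ‖ ^ 2)) ^ 2 + 8 / 5 * ‖y‖ ^ 2) := by
  rw [norm_sub_sq_real, norm_add_sq_real]
  simp only [norm_smul, real_inner_smul_left, real_inner_smul_right, mul_pow, Real.norm_eq_abs,
    sq_abs, div_pow]
  rw [Real.sq_sqrt (by positivity), real_inner_comm φ x, real_inner_comm φ y]
  rw [inner_add_right, real_inner_smul_right] at hs
  have hp := abs_real_inner_le_norm φ y
  obtain ⟨r, hr⟩ : ∃ r, r = √(1 + ‖φ‖ ^ 2) := ⟨_, rfl⟩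
  have hr0 : 0 < r := hr ▸ by positivity
  have hr2 : 1 + ‖φ‖ ^ 2 = r ^ 2 := by rw [hr, Real.sq_sqrt (by positivity)]
  have hφr : ‖φ‖ ≤ r := abs_le_of_sq_le_sq' (by linarith) hr0.le |>.2
  rw [hr2]
  have hx : ⟪φ, x⟫ = s - (1 - β) * ⟪φ, y⟫ := by linarith
  rw [hx]
  generalize ⟪φ, y⟫ = p at *
  obtain ⟨σ, rfl⟩ : ∃ σ, s = σ * r := ⟨s / r, by field_simp⟩
  obtain ⟨q, rfl⟩ : ∃ q, p = q * r := ⟨p / r, by field_simp⟩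
  have hq : |q| ≤ ‖y‖ := by
    rw [abs_mul, abs_of_pos hr0] at hp
    nlinarith [norm_nonneg y]
  have hq2 : q ^ 2 ≤ ‖y‖ ^ 2 := sq_le_sq.2 (by rwa [abs_norm])
  have hf : ‖φ‖ ^ 2 = r ^ 2 - 1 := by linarith
  have e1 : (γ / r ^ 2) ^ 2 * (σ * r) ^ 2 * ‖φ‖ ^ 2 ≤ γ ^ 2 * σ ^ 2 := by
    have : (γ / r ^ 2) ^ 2 * (σ * r) ^ 2 * ‖φ‖ ^ 2 = γ ^ 2 * σ ^ 2 * (‖φ‖ ^ 2 / r ^ 2) := by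
      field_simp
    rw [this]
    refine mul_le_of_le_one_right (by positivity) ?_
    rw [div_le_one (by positivity)]
    linarith
  have e2 : γ / r ^ 2 * (σ * r) * (σ * r - (1 - β) * (q * r))
      = γ * σ * (σ - (1 - β) * q) := by field_simp
  have e3 : γ / r ^ 2 * (σ * r) * ((1 - β) * (q * r)) = (1 - β) * γ * σ * q := by field_simp
  have e4 : (σ * r) ^ 2 / r ^ 2 = σ ^ 2 := by field_simp
  have key : 4 * (1 - β) * (γ * σ * q) + γ * 11 / 8 * σ ^ 2
      ≤ 2 * γ * σ ^ 2 - 2 * γ ^ 2 * σ ^ 2 + 32 / 5 * γ * q ^ 2 := by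
    have h1 := mul_nonneg hγ0.le (sq_nonneg ((1 - β) * σ - 16 / 5 * q))
    have h2 : 0 ≤ (β * (2 - β) / 8 - γ) * (γ * σ ^ 2) :=
      mul_nonneg (by linarith) (by positivity)
    have h3 : 0 ≤ γ * σ ^ 2 * (β * (2 - β)) := mul_nonneg (by positivity) (by linarith)
    linarith
  have h5 : 8 * γ * ‖y‖ ^ 2 ≤ β * (2 - β) * ‖y‖ ^ 2 :=
    mul_le_mul_of_nonneg_right (by linarith) (by positivity)
  have h6 := mul_le_mul_of_nonneg_left hq2 hγ0.le
  rw [e2, e3, e4]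
  simp only [mul_pow, div_pow] at e1 ⊢
  linarith

/-- Contraction of the heavy-ball error over a window of length `T` along which the
regressor is exciting in the direction of the initial error `x 0`. -/
lemma heavyBall_window_contraction (φ x y : ℕ → E) {β γ : ℝ} (hβ0 : 0 < β) (hβ2 : β < 2)
    (hγ0 : 0 < γ) (hγ : γ ≤ β * (2 - β) / 8)
    (hx : ∀ i, x (i + 1) =
      x i - ((γ / (1 + ‖φ i‖ ^ 2)) * ⟪φ i, x i + (1 - β) • y i⟫) • φ i)
    (hy : ∀ i, y (i + 1) =
      (1 - β) • y i + ((γ / (1 + ‖φ i‖ ^ 2)) * ⟪φ i, x i + (1 - β) • y i⟫) • φ i)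
    {T : ℕ} (hT : 1 ≤ T) {ε Φ : ℝ} (hε : 0 < ε)
    (hPE : ε * T * ‖x 0‖ ≤ ∑ i ∈ Finset.range T, |⟪φ i, x 0⟫|)
    (hΦ : ∀ i, ‖φ i‖ ≤ Φ) {lam μ : ℝ} (hlam0 : 0 < lam) (hlam1 : lam < 1)
    (hμ₂ : μ ≤ 21 / 32 * T * (ε / √(1 + Φ ^ 2)) ^ 2 * lam * γ / (1 + γ * T) ^ 2)
    (hμ₃ : μ ≤ 11 / 8 * (1 - lam) * γ / T) :
    ‖x T‖ ^ 2 + ‖y T‖ ^ 2 ≤ (1 - μ) * (‖x 0‖ ^ 2 + ‖y 0‖ ^ 2) := by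
  obtain ⟨σ, hσ⟩ : ∃ σ : ℕ → ℝ,
      ∀ i, σ i = |⟪φ i, x i + (1 - β) • y i⟫| / √(1 + ‖φ i‖ ^ 2) := ⟨_, fun _ => rfl⟩
  have hσ0 : ∀ i, 0 ≤ σ i := fun i => by rw [hσ]; positivity
  have hT1 : (1 : ℝ) ≤ T := by exact_mod_cast hT
  have hsum : ∀ t, ‖x t‖ ^ 2 + ‖y t‖ ^ 2 ≤ ‖x 0‖ ^ 2 + ‖y 0‖ ^ 2
      - γ * (11 / 8 * ∑ i ∈ Finset.range t, σ i ^ 2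
        + 8 / 5 * ∑ i ∈ Finset.range t, ‖y i‖ ^ 2) := by
    intro t
    induction t with
    | zero => simp
    | succ t ih =>
      have h := heavyBall_step_decrease (φ t) (x t) (y t) hγ0 hγ rfl
      rw [← hx, ← hy, ← hσ] at h
      rw [Finset.sum_range_succ, Finset.sum_range_succ]
      linarith
  have hsqrt : ∀ i, ‖φ i‖ ≤ √(1 + ‖φ i‖ ^ 2) := fun i =>
    Real.le_sqrt_of_sq_le (by linarith)
  have hdrift : ∀ t, ‖x t - x 0‖ ≤ γ * ∑ i ∈ Finset.range t, σ i := by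
    intro t
    induction t with
    | zero => simp
    | succ t ih =>
      have h1 : ‖((γ / (1 + ‖φ t‖ ^ 2)) * ⟪φ t, x t + (1 - β) • y t⟫) • φ t‖ ≤ γ * σ t := by
        rw [norm_smul, norm_mul, Real.norm_eq_abs, Real.norm_eq_abs,
          abs_of_pos (by positivity), hσ]
        have hr : 0 < √(1 + ‖φ t‖ ^ 2) := by positivity
        have hr2 : √(1 + ‖φ t‖ ^ 2) ^ 2 = 1 + ‖φ t‖ ^ 2 := Real.sq_sqrt (by positivity)
        rw [← hr2, Real.sqrt_sq hr.le]
        calc γ / √(1 + ‖φ t‖ ^ 2) ^ 2 * |⟪φ t, x t + (1 - β) • y t⟫| * ‖φ t‖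
            ≤ γ / √(1 + ‖φ t‖ ^ 2) ^ 2 * |⟪φ t, x t + (1 - β) • y t⟫|
              * √(1 + ‖φ t‖ ^ 2) := by gcongr; exact hsqrt t
          _ = _ := by field_simp
      rw [Finset.sum_range_succ, hx, sub_right_comm]
      calc _ ≤ _ := norm_sub_le _ _
        _ ≤ _ := by linarith
  obtain ⟨A, hA⟩ : ∃ A, A = ∑ i ∈ Finset.range T, σ i := ⟨_, rfl⟩
  obtain ⟨B, hB⟩ : ∃ B, B = ∑ i ∈ Finset.range T, ‖y i‖ := ⟨_, rfl⟩
  obtain ⟨S, hS⟩ : ∃ S, S = ∑ i ∈ Finset.range T, σ i ^ 2 := ⟨_, rfl⟩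
  obtain ⟨R, hR⟩ : ∃ R, R = ∑ i ∈ Finset.range T, ‖y i‖ ^ 2 := ⟨_, rfl⟩
  have hA0 : 0 ≤ A := hA ▸ Finset.sum_nonneg fun i _ => hσ0 i
  have hB0 : 0 ≤ B := hB ▸ Finset.sum_nonneg fun i _ => norm_nonneg _
  have hS0 : 0 ≤ S := hS ▸ Finset.sum_nonneg fun i _ => sq_nonneg _
  have hAS : A ^ 2 ≤ T * S := by
    rw [hA, hS]; simpa using sq_sum_le_card_mul_sum_sq (s := Finset.range T) (f := σ)
  have hBR : B ^ 2 ≤ T * R := by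
    rw [hB, hR]
    simpa using sq_sum_le_card_mul_sum_sq (s := Finset.range T) (f := fun i => ‖y i‖)
  have hyR : ‖y 0‖ ^ 2 ≤ R := by
    rw [hR]
    exact Finset.single_le_sum (f := fun i => ‖y i‖ ^ 2) (fun i _ => sq_nonneg _)
      (Finset.mem_range.2 hT)
  have hM0 : 0 < √(1 + Φ ^ 2) := by positivity
  have hterm : ∀ i ∈ Finset.range T,
      |⟪φ i, x 0⟫| ≤ √(1 + Φ ^ 2) * (σ i + ‖y i‖ + γ * A) := by
    intro i hi
    have hN0 : 0 < √(1 + ‖φ i‖ ^ 2) := by positivity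
    have hNM : √(1 + ‖φ i‖ ^ 2) ≤ √(1 + Φ ^ 2) := by gcongr; exact hΦ i
    have hdec : x 0 = (x i + (1 - β) • y i) - (1 - β) • y i - (x i - x 0) := by abel
    have h1 : |⟪φ i, x i + (1 - β) • y i⟫| = √(1 + ‖φ i‖ ^ 2) * σ i := by
      rw [hσ]; field_simp
    have h2 : |⟪φ i, (1 - β) • y i⟫| ≤ √(1 + ‖φ i‖ ^ 2) * ‖y i‖ := by
      refine (abs_real_inner_le_norm _ _).trans ?_
      refine mul_le_mul (hsqrt i) ?_ (norm_nonneg _) hN0.le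
      rw [norm_smul]
      exact mul_le_of_le_one_left (norm_nonneg _)
        (by rw [Real.norm_eq_abs, abs_le]; constructor <;> linarith)
    have h3 : |⟪φ i, x i - x 0⟫| ≤ √(1 + ‖φ i‖ ^ 2) * (γ * A) := by
      refine (abs_real_inner_le_norm _ _).trans ?_
      refine mul_le_mul (hsqrt i) ((hdrift i).trans ?_) (norm_nonneg _) hN0.le
      rw [hA]
      gcongr
      · exact fun j _ _ => hσ0 j
      · exact (Finset.mem_range.1 hi).le
    calc |⟪φ i, x 0⟫|
        = |⟪φ i, x i + (1 - β) • y i⟫ - ⟪φ i, (1 - β) • y i⟫ - ⟪φ i, x i - x 0⟫| := by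
          rw [← inner_sub_right, ← inner_sub_right, ← hdec]
      _ ≤ |⟪φ i, x i + (1 - β) • y i⟫| + |⟪φ i, (1 - β) • y i⟫| + |⟪φ i, x i - x 0⟫| :=
          (abs_sub _ _).trans (add_le_add_left (abs_sub _ _) _)
      _ ≤ √(1 + ‖φ i‖ ^ 2) * (σ i + ‖y i‖ + γ * A) := by linarith
      _ ≤ _ := by
          have := hσ0 i
          gcongr
  have hexc : ε / √(1 + Φ ^ 2) * T * ‖x 0‖ ≤ (1 + γ * T) * (A + B) := by
    have h := hPE.trans (Finset.sum_le_sum hterm)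
    rw [← Finset.mul_sum, Finset.sum_add_distrib, Finset.sum_add_distrib, ← hA, ← hB] at h
    simp only [Finset.sum_const, Finset.card_range, nsmul_eq_mul] at h
    have h' : ε / √(1 + Φ ^ 2) * T * ‖x 0‖ ≤ A + B + T * (γ * A) := by
      rw [div_mul_eq_mul_div, div_mul_eq_mul_div, div_le_iff₀ hM0]
      linarith
    have : 0 ≤ γ * T * B := by positivity
    linarith
  have hmain := hsum T
  rw [← hS, ← hR] at hmain
  obtain ⟨W, hW⟩ : ∃ W, W = ‖x 0‖ ^ 2 + ‖y 0‖ ^ 2 := ⟨_, rfl⟩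
  have hW0 : 0 ≤ W := hW ▸ by positivity
  rw [← hW] at hmain ⊢
  suffices h : μ * W ≤ γ * (11 / 8 * S + 8 / 5 * R) by linarith
  rcases le_or_gt ((1 - lam) * W) (‖y 0‖ ^ 2) with hc | hc
  · calc μ * W ≤ 11 / 8 * (1 - lam) * γ / T * W := by gcongr
      _ ≤ 11 / 8 * (1 - lam) * γ * W := by
          gcongr
          refine div_le_self ?_ hT1
          have : 0 < 1 - lam := by linarith
          positivity
      _ = γ * (11 / 8 * ((1 - lam) * W)) := by ring
      _ ≤ γ * (11 / 8 * S + 8 / 5 * R) := by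
          gcongr
          linarith [sq_nonneg ‖y 0‖]
  · have hxl : lam * W ≤ ‖x 0‖ ^ 2 := by linarith
    obtain ⟨e, he⟩ : ∃ e, e = ε / √(1 + Φ ^ 2) := ⟨_, rfl⟩
    have he0 : 0 < e := he ▸ by positivity
    rw [← he] at hexc hμ₂
    have hD : 0 < 1 + γ * T := by positivity
    have hsq := pow_le_pow_left₀ (by positivity) hexc 2
    have hAB : 21 / 32 * (A + B) ^ 2 ≤ T * (11 / 8 * S + 8 / 5 * R) := by
      nlinarith [sq_nonneg (11 / 8 * A - 8 / 5 * B), sq_nonneg A, sq_nonneg B]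
    have h1 : 21 / 32 * (e * T * ‖x 0‖) ^ 2
        ≤ (1 + γ * T) ^ 2 * (T * (11 / 8 * S + 8 / 5 * R)) := by
      calc _ ≤ 21 / 32 * ((1 + γ * T) * (A + B)) ^ 2 := by gcongr
        _ = (1 + γ * T) ^ 2 * (21 / 32 * (A + B) ^ 2) := by ring
        _ ≤ _ := by gcongr
    have h2 : 21 / 32 * T * e ^ 2 * ‖x 0‖ ^ 2
        ≤ (1 + γ * T) ^ 2 * (11 / 8 * S + 8 / 5 * R) := by
      refine le_of_mul_le_mul_left ?_ (by linarith : (0 : ℝ) < T)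
      linarith
    calc μ * W ≤ 21 / 32 * T * e ^ 2 * lam * γ / (1 + γ * T) ^ 2 * W := by gcongr
      _ = γ * (21 / 32 * T * e ^ 2 * (lam * W)) / (1 + γ * T) ^ 2 := by ring
      _ ≤ γ * (21 / 32 * T * e ^ 2 * ‖x 0‖ ^ 2) / (1 + γ * T) ^ 2 := by gcongr
      _ ≤ γ * ((1 + γ * T) ^ 2 * (11 / 8 * S + 8 / 5 * R)) / (1 + γ * T) ^ 2 := by gcongr
      _ = _ := by field_simp

end HeavyBall

theorem hb_one_window_contraction
    (n : ℕ) (hn : 1 ≤ n)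
    (θstar : EuclideanSpace ℝ (Fin n))
    (φ θ ϑ : ℕ → EuclideanSpace ℝ (Fin n))
    (β γ : ℝ) (hβ0 : 0 < β) (hβ2 : β < 2)
    (hγ0 : 0 < γ) (hγ : γ ≤ β * (2 - β) / 8)
    (hθ : ∀ k, θ (k + 1) = θ k - β • (θ k - ϑ k))
    (hϑ : ∀ k, ϑ (k + 1) =
      ϑ k - ((γ / (1 + ‖φ k‖ ^ 2)) * ⟪φ k, θ (k + 1) - θstar⟫) • φ k)
    (V : ℕ → ℝ)
    (hV : ∀ k, V k = (1 / γ) * ‖ϑ k - θstar‖ ^ 2 + (1 / γ) * ‖θ k - ϑ k‖ ^ 2)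
    (ΔT : ℕ) (hΔT : 1 ≤ ΔT)
    (ε : ℝ) (hε : 0 < ε)
    (hPE : ∀ m, ΔT ≤ m → ∀ w : EuclideanSpace ℝ (Fin n), ‖w‖ = 1 →
      ε ≤ (1 / (ΔT : ℝ)) * ∑ i ∈ Finset.Ico (m - ΔT) m, |⟪φ i, w⟫|)
    (Φ : ℝ) (hΦ : ∀ m, ‖φ m‖ ≤ Φ)
    (lam η : ℝ) (hlam0 : 0 < lam) (hlam1 : lam < 1) (hη : 0 < η)
    (hηε : γ * η * |1 - β| < ε / Real.sqrt (1 + Φ ^ 2))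
    (μ : ℝ)
    (hμ : μ = min (min ((11 / 8) * lam * γ * η ^ 2 / (ΔT : ℝ))
      ((21 / 32) * (ΔT : ℝ) * (ε / Real.sqrt (1 + Φ ^ 2) - γ * η * |1 - β|) ^ 2 *
        lam * γ / (1 + γ * ΔT) ^ 2))
      ((11 / 8) * (1 - lam) * γ / (ΔT : ℝ)))
    :
    ∀ k, ΔT ≤ k → V k ≤ (1 - μ) * V (k - ΔT) := by
  intro k hk
  obtain ⟨m, rfl⟩ := Nat.exists_eq_add_of_le' hk
  have hT0 : (0 : ℝ) < ΔT := by exact_mod_cast hΔT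
  have herr : ∀ i, θ (i + 1) - θstar = (ϑ i - θstar) + (1 - β) • (θ i - ϑ i) := by
    intro i; rw [hθ]; module
  have hx : ∀ i, ϑ (m + (i + 1)) - θstar = (ϑ (m + i) - θstar) -
      ((γ / (1 + ‖φ (m + i)‖ ^ 2)) *
        ⟪φ (m + i), (ϑ (m + i) - θstar) + (1 - β) • (θ (m + i) - ϑ (m + i))⟫) •
          φ (m + i) := by
    intro i; rw [← add_assoc, hϑ, herr]; abel
  have hy : ∀ i, θ (m + (i + 1)) - ϑ (m + (i + 1)) = (1 - β) • (θ (m + i) - ϑ (m + i)) +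
      ((γ / (1 + ‖φ (m + i)‖ ^ 2)) *
        ⟪φ (m + i), (ϑ (m + i) - θstar) + (1 - β) • (θ (m + i) - ϑ (m + i))⟫) •
          φ (m + i) := by
    intro i; rw [← add_assoc, hϑ, herr, hθ]; module
  have hexc : ε * ΔT * ‖ϑ (m + 0) - θstar‖
      ≤ ∑ i ∈ Finset.range ΔT, |⟪φ (m + i), ϑ (m + 0) - θstar⟫| := by
    generalize ϑ (m + 0) - θstar = v
    rcases eq_or_ne v 0 with rfl | hv
    · simp
    have hv0 : 0 < ‖v‖ := norm_pos_iff.2 hv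
    have h := hPE (m + ΔT) hk (‖v‖⁻¹ • v) (norm_smul_inv_norm hv)
    rw [Nat.add_sub_cancel, Finset.sum_Ico_eq_sum_range, Nat.add_sub_cancel_left] at h
    simp only [real_inner_smul_right, abs_mul, abs_inv, abs_norm] at h
    rw [← Finset.mul_sum] at h
    generalize ∑ i ∈ Finset.range ΔT, |⟪φ (m + i), v⟫| = P at *
    calc ε * ΔT * ‖v‖ ≤ 1 / ΔT * (‖v‖⁻¹ * P) * ΔT * ‖v‖ := by gcongr
      _ = P := by field_simp
  have hμ₂ : μ ≤ 21 / 32 * ΔT * (ε / √(1 + Φ ^ 2)) ^ 2 * lam * γ / (1 + γ * ΔT) ^ 2 := by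
    rw [hμ]
    refine (min_le_left _ _).trans ((min_le_right _ _).trans ?_)
    have : 0 ≤ ε / √(1 + Φ ^ 2) - γ * η * |1 - β| := by linarith
    gcongr
    exact sub_le_self _ (by positivity)
  have hμ₃ : μ ≤ 11 / 8 * (1 - lam) * γ / ΔT := hμ ▸ min_le_right _ _
  have h := heavyBall_window_contraction (fun i => φ (m + i)) (fun i => ϑ (m + i) - θstar)
    (fun i => θ (m + i) - ϑ (m + i)) hβ0 hβ2 hγ0 hγ hx hy hΔT hε hexc (fun i => hΦ _)
    hlam0 hlam1 hμ₂ hμ₃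
  simp only [add_zero] at h
  rw [Nat.add_sub_cancel, hV, hV, ← mul_add, ← mul_add, mul_left_comm]
  gcongr
end

section
/- Theorem 1(ii) (exponential convergence of the Heavy Ball tuner): suppose 0 < β < 2, 0 < γ ≤ β(2−β)/8, the regressor is PE with level ε over window ΔT, ‖φ_k‖ ≤ Φ for all k, 0 < λ < 1, η > 0 satisfies γη|1−β| < ε₁ with ε₁ = ε/√(1+Φ²). Let μ = min{μ₁, μ₂, μ₃} where μ₁ = (11/8)λγη²/ΔT, μ₂ = (21/32)·ΔT·(ε₁ − γη|1−β|)²·λγ/(1+γΔT)², μ₃ = (11/8)(1−λ)γ/ΔT. Then for every k ≥ 0, V_k ≤ exp(−μ·⌊k/ΔT⌋)·V_0. -/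
open scoped RealInnerProductSpace

section HeavyBall

variable {E : Type*} [NormedAddCommGroup E] [InnerProductSpace ℝ E]

/-- Decrease of the Heavy Ball Lyapunov function in one step, for a normalised regressor `ψ`. -/
theorem heavyBall_step {β γ : ℝ} (hγ0 : 0 < γ) (hγ : γ ≤ β * (2 - β) / 8) {ψ : E} (hψ : ‖ψ‖ ≤ 1)
    (x y : E) {e : ℝ} (he : e = ⟪ψ, x + (1 - β) • y⟫) :
    ‖x - (γ * e) • ψ‖ ^ 2 + ‖(1 - β) • y + (γ * e) • ψ‖ ^ 2 ≤
      ‖x‖ ^ 2 + ‖y‖ ^ 2 - γ * (11 / 8 * (‖y‖ ^ 2 + e ^ 2)) := by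
  rw [norm_sub_sq_real, norm_add_sq_real]
  simp only [inner_smul_left, inner_smul_right, norm_smul, mul_pow, Real.norm_eq_abs, sq_abs,
    inner_add_right, conj_trivial] at he ⊢
  rw [real_inner_comm ψ x, real_inner_comm ψ y]
  have hq : ⟪ψ, y⟫ ^ 2 ≤ ‖y‖ ^ 2 := by
    rw [← sq_abs]
    gcongr
    exact (abs_real_inner_le_norm ψ y).trans (mul_le_of_le_one_left (norm_nonneg y) hψ)
  have hp : ‖ψ‖ ^ 2 ≤ 1 := pow_le_one₀ (norm_nonneg _) hψ
  have hs : ⟪ψ, x⟫ = e - (1 - β) * ⟪ψ, y⟫ := by linarith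
  rw [hs]
  generalize ⟪ψ, y⟫ = q at *
  generalize ‖ψ‖ ^ 2 = p at *
  generalize ‖y‖ ^ 2 = Y at *
  have hA : 0 < β * (2 - β) - 11 / 8 * γ := by linarith
  have hAB : 4 * γ ^ 2 * (1 - β) ^ 2 ≤
      (β * (2 - β) - 11 / 8 * γ) * (γ * (5 / 8 - 2 * γ)) := by
    have hb : β * (2 - β) ≤ 1 := by nlinarith [sq_nonneg (1 - β)]
    have h1 : (1 - β) ^ 2 ≤ 1 - 8 * γ := by linarith
    have h2 : γ * (4 * (1 - β) ^ 2) ≤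
        (β * (2 - β) - 11 / 8 * γ) * (5 / 8 - 2 * γ) := by
      nlinarith [mul_nonneg (sub_nonneg.2 hγ) (show 0 ≤ 5 / 8 - 2 * γ by linarith)]
    nlinarith [mul_le_mul_of_nonneg_left h2 hγ0.le]
  have hform : 0 ≤ (β * (2 - β) - 11 / 8 * γ) * q ^ 2 + γ * (5 / 8 - 2 * γ) * e ^ 2
      - 4 * γ * (1 - β) * e * q := by
    refine nonneg_of_mul_nonneg_right ?_ hA
    nlinarith [sq_nonneg ((β * (2 - β) - 11 / 8 * γ) * q - 2 * γ * (1 - β) * e),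
      mul_le_mul_of_nonneg_right hAB (sq_nonneg e)]
  have h3 : γ ^ 2 * e ^ 2 * p ≤ γ ^ 2 * e ^ 2 := mul_le_of_le_one_right (by positivity) hp
  have h4 := mul_le_mul_of_nonneg_left hq hA.le
  linarith

/-- Excitation over a window is bounded by the accumulated prediction and momentum errors. -/
theorem sum_abs_inner_le {γ r : ℝ} (hγ0 : 0 ≤ γ) {x y ψ : ℕ → E} {e : ℕ → ℝ}
    (hψ : ∀ i, ‖ψ i‖ ≤ 1) (hx : ∀ i, x (i + 1) = x i - (γ * e i) • ψ i)
    (he : ∀ i, e i = ⟪ψ i, x i + r • y i⟫) (T : ℕ) :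
    ∑ i ∈ Finset.range T, |⟪ψ i, x 0⟫| ≤
      (1 + γ * T) * ∑ i ∈ Finset.range T, |e i| + |r| * ∑ i ∈ Finset.range T, ‖y i‖ := by
  have hinner (i : ℕ) (z : E) : |⟪ψ i, z⟫| ≤ ‖z‖ :=
    (abs_real_inner_le_norm _ _).trans (mul_le_of_le_one_left (norm_nonneg z) (hψ i))
  have hdrift (i : ℕ) : ‖x 0 - x i‖ ≤ γ * ∑ j ∈ Finset.range i, |e j| := by
    induction i with
    | zero => simp
    | succ i ih =>
      rw [hx, Finset.sum_range_succ, mul_add, sub_sub_eq_add_sub, add_sub_right_comm]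
      refine (norm_add_le _ _).trans (add_le_add ih ?_)
      rw [norm_smul, Real.norm_eq_abs, abs_mul, abs_of_nonneg hγ0]
      exact mul_le_of_le_one_right (by positivity) (hψ i)
  have hterm : ∀ i ∈ Finset.range T, |⟪ψ i, x 0⟫| ≤
      |e i| + |r| * ‖y i‖ + γ * ∑ j ∈ Finset.range T, |e j| := by
    intro i hi
    have hsplit : ⟪ψ i, x 0⟫ = e i - r * ⟪ψ i, y i⟫ + ⟪ψ i, x 0 - x i⟫ := by
      rw [he, inner_sub_right, inner_add_right, inner_smul_right]
      ring
    have hsub : ∑ j ∈ Finset.range i, |e j| ≤ ∑ j ∈ Finset.range T, |e j| :=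
      Finset.sum_le_sum_of_subset_of_nonneg
        (Finset.range_mono (Finset.mem_range.1 hi).le) fun _ _ _ => abs_nonneg _
    rw [hsplit]
    refine (abs_add_le _ _).trans (add_le_add ((abs_sub _ _).trans ?_) ?_)
    · rw [abs_mul]
      gcongr
      exact hinner _ _
    · exact (hinner _ _).trans ((hdrift i).trans (by gcongr))
  refine (Finset.sum_le_sum hterm).trans (le_of_eq ?_)
  simp only [Finset.sum_add_distrib, ← Finset.mul_sum, Finset.sum_const, Finset.card_range,
    nsmul_eq_mul]
  ring

/-- Total dissipation over a window on which the normalised regressor is excited with level `c`. -/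
theorem le_sum_norm_sq_add_sq {γ r c : ℝ} (hγ0 : 0 ≤ γ) (hr : |r| ≤ 1) (hc : 0 ≤ c)
    {x y ψ : ℕ → E} {e : ℕ → ℝ}
    (hψ : ∀ i, ‖ψ i‖ ≤ 1) (hx : ∀ i, x (i + 1) = x i - (γ * e i) • ψ i)
    (he : ∀ i, e i = ⟪ψ i, x i + r • y i⟫) {T : ℕ} (hT : 1 ≤ T)
    (hPE : T * (c * ‖x 0‖) ≤ ∑ i ∈ Finset.range T, |⟪ψ i, x 0⟫|) :
    T * c ^ 2 * ‖x 0‖ ^ 2 / (2 * (1 + γ * T) ^ 2) ≤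
      ∑ i ∈ Finset.range T, (‖y i‖ ^ 2 + e i ^ 2) := by
  have hT0 : (0 : ℝ) < T := by exact_mod_cast hT
  have hbound := hPE.trans (sum_abs_inner_le hγ0 hψ hx he T)
  have hS := sq_sum_le_card_mul_sum_sq (s := Finset.range T) (f := fun i => |e i|)
  have hY := sq_sum_le_card_mul_sum_sq (s := Finset.range T) (f := fun i => ‖y i‖)
  simp only [Finset.card_range, sq_abs] at hS hY
  rw [Finset.sum_add_distrib, div_le_iff₀ (by positivity)]
  have hS0 : 0 ≤ ∑ i ∈ Finset.range T, |e i| := by positivity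
  have hY0 : 0 ≤ ∑ i ∈ Finset.range T, ‖y i‖ := by positivity
  generalize ∑ i ∈ Finset.range T, |e i| = S at *
  generalize ∑ i ∈ Finset.range T, ‖y i‖ = Z at *
  generalize ∑ i ∈ Finset.range T, e i ^ 2 = S₂ at *
  generalize ∑ i ∈ Finset.range T, ‖y i‖ ^ 2 = Z₂ at *
  have hg : 1 ≤ 1 + γ * T := le_add_of_nonneg_right (by positivity)
  have h1 : T * (c * ‖x 0‖) ≤ (1 + γ * T) * (S + Z) := by
    nlinarith [mul_le_mul_of_nonneg_right (hr.trans hg) hY0]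
  have h2 : (T * (c * ‖x 0‖)) ^ 2 ≤ ((1 + γ * T) * (S + Z)) ^ 2 := by gcongr
  have h3 : (S + Z) ^ 2 ≤ 2 * (T * (Z₂ + S₂)) := by nlinarith [sq_nonneg (S - Z)]
  refine le_of_mul_le_mul_left ?_ hT0
  nlinarith [mul_le_mul_of_nonneg_left h3 (sq_nonneg (1 + γ * T))]

/-- Dividing by `√(1 + ‖φ‖²)` costs at most the factor `√(1 + Φ²)` in the excitation level. -/
theorem abs_inner_div_le_abs_inner_normalized {φ : E} {Φ : ℝ} (hφ : ‖φ‖ ≤ Φ) (w : E) :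
    |⟪φ, w⟫| / √(1 + Φ ^ 2) ≤ |⟪(√(1 + ‖φ‖ ^ 2))⁻¹ • φ, w⟫| := by
  rw [inner_smul_left, conj_trivial, abs_mul, abs_of_nonneg (inv_nonneg.2 (Real.sqrt_nonneg _)),
    div_eq_inv_mul]
  gcongr

theorem norm_normalized_le_one (φ : E) : ‖(√(1 + ‖φ‖ ^ 2))⁻¹ • φ‖ ≤ 1 := by
  rw [norm_smul, norm_inv, Real.norm_of_nonneg (Real.sqrt_nonneg _), inv_mul_le_iff₀ (by positivity),
    mul_one]
  exact Real.le_sqrt_of_sq_le (by linarith)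

theorem excited_rate_mul_le {γ T c δ lam v X : ℝ} (hγ : 0 ≤ γ) (hT : 0 ≤ T) (hδ : 0 ≤ δ)
    (hδc : δ ≤ c) (hv : 0 ≤ lam * (γ * v)) (hX : lam * (γ * v) ≤ X) :
    21 / 32 * T * (c - δ) ^ 2 * lam * γ / (1 + γ * T) ^ 2 * v ≤
      11 / 8 * (T * c ^ 2 * X / (2 * (1 + γ * T) ^ 2)) := by
  have hsq : (c - δ) ^ 2 ≤ c ^ 2 := pow_le_pow_left₀ (by linarith) (by linarith) 2
  calc 21 / 32 * T * (c - δ) ^ 2 * lam * γ / (1 + γ * T) ^ 2 * v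
      = 21 / 32 * (T * (c - δ) ^ 2 * (lam * (γ * v)) / (1 + γ * T) ^ 2) := by ring
    _ ≤ 11 / 16 * (T * c ^ 2 * X / (1 + γ * T) ^ 2) := by
      refine mul_le_mul (by norm_num) ?_ (by positivity) (by norm_num)
      gcongr
    _ = 11 / 8 * (T * c ^ 2 * X / (2 * (1 + γ * T) ^ 2)) := by
      field_simp
      ring

/-- A nonincreasing sequence that contracts by `1 - μ` over windows of length `T` decays
exponentially in the number of completed windows. -/
theorem le_exp_mul_of_antitone_of_window {V : ℕ → ℝ} {μ : ℝ} {T : ℕ} (hV : ∀ k, 0 ≤ V k)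
    (hanti : Antitone V) (hdecay : ∀ k, V (k + T) ≤ (1 - μ) * V k) (k : ℕ) :
    V k ≤ Real.exp (-μ * ((k / T : ℕ) : ℝ)) * V 0 := by
  have hblock (j : ℕ) : V (T * j) ≤ Real.exp (-μ * j) * V 0 := by
    induction j with
    | zero => simp
    | succ j ih =>
      calc V (T * (j + 1)) ≤ (1 - μ) * V (T * j) := hdecay _
        _ ≤ Real.exp (-μ) * V (T * j) :=
          mul_le_mul_of_nonneg_right (Real.one_sub_le_exp_neg μ) (hV _)
        _ ≤ Real.exp (-μ) * (Real.exp (-μ * j) * V 0) := by gcongr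
        _ = Real.exp (-μ * ((j + 1 : ℕ) : ℝ)) * V 0 := by
          rw [← mul_assoc, ← Real.exp_add]
          push_cast
          ring_nf
  exact (hanti (Nat.mul_div_le k T)).trans (hblock _)

/-- Exponential decay of the Heavy Ball Lyapunov function in error coordinates, for a normalised
regressor excited with level `c` over windows of length `T`. -/
theorem normalized_heavyBall_decay {β γ : ℝ} (hβ0 : 0 < β) (hβ2 : β < 2) (hγ0 : 0 < γ)
    (hγ : γ ≤ β * (2 - β) / 8) {x y ψ : ℕ → E} {e V : ℕ → ℝ} (hψ : ∀ k, ‖ψ k‖ ≤ 1)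
    (hx : ∀ k, x (k + 1) = x k - (γ * e k) • ψ k)
    (hy : ∀ k, y (k + 1) = (1 - β) • y k + (γ * e k) • ψ k)
    (he : ∀ k, e k = ⟪ψ k, x k + (1 - β) • y k⟫)
    (hγV : ∀ k, γ * V k = ‖x k‖ ^ 2 + ‖y k‖ ^ 2) {T : ℕ} (hT : 1 ≤ T) {c δ lam μ : ℝ} (hc : 0 < c)
    (hexc : ∀ k w, T * (c * ‖w‖) ≤ ∑ i ∈ Finset.range T, |⟪ψ (k + i), w⟫|)
    (hlam0 : 0 < lam) (hlam1 : lam < 1) (hδ : 0 ≤ δ) (hδc : δ ≤ c)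
    (hμ₂ : μ ≤ 21 / 32 * T * (c - δ) ^ 2 * lam * γ / (1 + γ * T) ^ 2)
    (hμ₃ : μ ≤ 11 / 8 * (1 - lam) * γ / T) (k : ℕ) :
    V k ≤ Real.exp (-μ * ((k / T : ℕ) : ℝ)) * V 0 := by
  have hV0 (k : ℕ) : 0 ≤ V k := by
    refine nonneg_of_mul_nonneg_right ?_ hγ0
    rw [hγV]
    positivity
  have hstep (k : ℕ) : V (k + 1) ≤ V k - 11 / 8 * (‖y k‖ ^ 2 + e k ^ 2) := by
    refine le_of_mul_le_mul_left ?_ hγ0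
    rw [mul_sub, hγV, hγV, hx, hy]
    exact heavyBall_step hγ0 hγ (hψ k) (x k) (y k) (he k)
  have hanti : Antitone V := antitone_nat_of_succ_le fun k =>
    (hstep k).trans (sub_le_self _ (by positivity))
  have hwindow (k T : ℕ) :
      V (k + T) ≤ V k - 11 / 8 * ∑ i ∈ Finset.range T, (‖y (k + i)‖ ^ 2 + e (k + i) ^ 2) := by
    induction T with
    | zero => simp
    | succ T ih =>
      rw [Finset.sum_range_succ]
      have h1 := hstep (k + T)
      rw [← add_assoc]
      linarith
  have hr : |1 - β| ≤ 1 := abs_le.2 ⟨by linarith, by linarith⟩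
  have hdecay (k : ℕ) : V (k + T) ≤ (1 - μ) * V k := by
    have hdis : μ * V k ≤
        11 / 8 * ∑ i ∈ Finset.range T, (‖y (k + i)‖ ^ 2 + e (k + i) ^ 2) := by
      rcases le_or_gt (lam * (γ * V k)) (‖x k‖ ^ 2) with hcase | hcase
      · have h1 := le_sum_norm_sq_add_sq (x := fun i => x (k + i)) (y := fun i => y (k + i))
          (ψ := fun i => ψ (k + i)) (e := fun i => e (k + i)) hγ0.le hr hc.le
          (fun i => hψ _) (fun i => hx _) (fun i => he _) hT (hexc k (x k))
        have h2 := excited_rate_mul_le hγ0.le T.cast_nonneg hδ hδc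
          (mul_nonneg hlam0.le (mul_nonneg hγ0.le (hV0 k))) hcase
        calc μ * V k ≤ _ := mul_le_mul_of_nonneg_right hμ₂ (hV0 k)
          _ ≤ _ := h2
          _ ≤ _ := mul_le_mul_of_nonneg_left h1 (by norm_num)
      · have h1 : ‖y k‖ ^ 2 ≤
            ∑ i ∈ Finset.range T, (‖y (k + i)‖ ^ 2 + e (k + i) ^ 2) :=
          (le_add_of_nonneg_right (sq_nonneg (e k))).trans
            (Finset.single_le_sum (f := fun i => ‖y (k + i)‖ ^ 2 + e (k + i) ^ 2)
              (fun _ _ => by positivity) (Finset.mem_range.2 hT))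
        have h2 : (11 / 8) * (1 - lam) * γ / T ≤ (11 / 8) * (1 - lam) * γ :=
          div_le_self (by have := sub_pos.2 hlam1; positivity) (by exact_mod_cast hT)
        have h3 := mul_le_mul_of_nonneg_right (hμ₃.trans h2) (hV0 k)
        linarith [hγV k]
    linarith [hwindow k T]
  exact le_exp_mul_of_antitone_of_window hV0 hanti hdecay k

end HeavyBall

theorem hb_exponential_convergence
    (n : ℕ) (hn : 1 ≤ n)
    (θstar : EuclideanSpace ℝ (Fin n))
    (φ θ ϑ : ℕ → EuclideanSpace ℝ (Fin n))
    (β γ : ℝ) (hβ0 : 0 < β) (hβ2 : β < 2)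
    (hγ0 : 0 < γ) (hγ : γ ≤ β * (2 - β) / 8)
    (hθ : ∀ k, θ (k + 1) = θ k - β • (θ k - ϑ k))
    (hϑ : ∀ k, ϑ (k + 1) =
      ϑ k - ((γ / (1 + ‖φ k‖ ^ 2)) * ⟪φ k, θ (k + 1) - θstar⟫) • φ k)
    (V : ℕ → ℝ)
    (hV : ∀ k, V k = (1 / γ) * ‖ϑ k - θstar‖ ^ 2 + (1 / γ) * ‖θ k - ϑ k‖ ^ 2)
    (ΔT : ℕ) (hΔT : 1 ≤ ΔT)
    (ε : ℝ) (hε : 0 < ε)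
    (hPE : ∀ m, ΔT ≤ m → ∀ w : EuclideanSpace ℝ (Fin n), ‖w‖ = 1 →
      ε ≤ (1 / (ΔT : ℝ)) * ∑ i ∈ Finset.Ico (m - ΔT) m, |⟪φ i, w⟫|)
    (Φ : ℝ) (hΦ : ∀ m, ‖φ m‖ ≤ Φ)
    (lam η : ℝ) (hlam0 : 0 < lam) (hlam1 : lam < 1) (hη : 0 < η)
    (hηε : γ * η * |1 - β| < ε / Real.sqrt (1 + Φ ^ 2))
    (μ : ℝ)
    (hμ : μ = min (min ((11 / 8) * lam * γ * η ^ 2 / (ΔT : ℝ))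
      ((21 / 32) * (ΔT : ℝ) * (ε / Real.sqrt (1 + Φ ^ 2) - γ * η * |1 - β|) ^ 2 *
        lam * γ / (1 + γ * ΔT) ^ 2))
      ((11 / 8) * (1 - lam) * γ / (ΔT : ℝ)))
    :
    ∀ k : ℕ, V k ≤ Real.exp (-μ * ((k / ΔT : ℕ) : ℝ)) * V 0 := by
  have hT0 : (0 : ℝ) < ΔT := by exact_mod_cast hΔT
  set x : ℕ → EuclideanSpace ℝ (Fin n) := fun k => ϑ k - θstar with hxdef
  set y : ℕ → EuclideanSpace ℝ (Fin n) := fun k => θ k - ϑ k with hydef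
  set ψ : ℕ → EuclideanSpace ℝ (Fin n) := fun k => (√(1 + ‖φ k‖ ^ 2))⁻¹ • φ k with hψdef
  set e : ℕ → ℝ := fun k => ⟪ψ k, x k + (1 - β) • y k⟫ with hedef
  have hψ (k : ℕ) : ‖ψ k‖ ≤ 1 := norm_normalized_le_one (φ k)
  have hd (k : ℕ) : θ (k + 1) - θstar = x k + (1 - β) • y k := by
    rw [hθ]
    simp only [hxdef, hydef]
    module
  have hupd (k : ℕ) : ((γ / (1 + ‖φ k‖ ^ 2)) * ⟪φ k, θ (k + 1) - θstar⟫) • φ k =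
      (γ * e k) • ψ k := by
    have hsq : (√(1 + ‖φ k‖ ^ 2))⁻¹ * (√(1 + ‖φ k‖ ^ 2))⁻¹ = (1 + ‖φ k‖ ^ 2)⁻¹ := by
      rw [← mul_inv, Real.mul_self_sqrt (by positivity)]
    rw [hd]
    simp only [hedef, hψdef, inner_smul_left, conj_trivial, smul_smul]
    congr 1
    rw [div_eq_mul_inv, ← hsq]
    ring
  have he (k : ℕ) : e k = ⟪ψ k, x k + (1 - β) • y k⟫ := rfl
  have hφψ (k : ℕ) (w : EuclideanSpace ℝ (Fin n)) :
      |⟪φ k, w⟫| / √(1 + Φ ^ 2) ≤ |⟪ψ k, w⟫| :=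
    abs_inner_div_le_abs_inner_normalized (hΦ k) w
  have hx (k : ℕ) : x (k + 1) = x k - (γ * e k) • ψ k := by
    rw [← hupd]
    simp only [hxdef]
    rw [hϑ]
    abel
  have hy (k : ℕ) : y (k + 1) = (1 - β) • y k + (γ * e k) • ψ k := by
    have h1 : y (k + 1) = (θ (k + 1) - θstar) - x (k + 1) := by simp [hydef, hxdef]
    rw [h1, hd, hx]
    abel
  have hγV (k : ℕ) : γ * V k = ‖x k‖ ^ 2 + ‖y k‖ ^ 2 := by
    rw [hV]
    field_simp
    rfl
  clear_value x y ψ e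
  set c := ε / √(1 + Φ ^ 2) with hc
  have hc0 : 0 < c := by positivity
  have hexc (k : ℕ) (w : EuclideanSpace ℝ (Fin n)) :
      ΔT * (c * ‖w‖) ≤ ∑ i ∈ Finset.range ΔT, |⟪ψ (k + i), w⟫| := by
    rcases eq_or_ne w 0 with rfl | hw
    · simp
    have hw0 : 0 < ‖w‖ := norm_pos_iff.2 hw
    have h1 := hPE (k + ΔT) (Nat.le_add_left _ _) (‖w‖⁻¹ • w) (norm_smul_inv_norm hw)
    rw [Nat.add_sub_cancel, Finset.sum_Ico_eq_sum_range, Nat.add_sub_cancel_left, one_div,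
      le_inv_mul_iff₀ hT0] at h1
    simp only [inner_smul_right, abs_mul, abs_of_nonneg (inv_nonneg.2 hw0.le)] at h1
    rw [← Finset.mul_sum, le_inv_mul_iff₀ hw0] at h1
    calc ΔT * (c * ‖w‖) = ‖w‖ * (ΔT * ε) / √(1 + Φ ^ 2) := by rw [hc]; ring
      _ ≤ (∑ i ∈ Finset.range ΔT, |⟪φ (k + i), w⟫|) / √(1 + Φ ^ 2) := by gcongr
      _ = ∑ i ∈ Finset.range ΔT, |⟪φ (k + i), w⟫| / √(1 + Φ ^ 2) := Finset.sum_div ..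
      _ ≤ _ := Finset.sum_le_sum fun i _ => hφψ _ w
  exact normalized_heavyBall_decay hβ0 hβ2 hγ0 hγ hψ hx hy he hγV hΔT hc0 hexc hlam0 hlam1
    (by positivity) hηε.le (hμ ▸ (min_le_left _ _).trans (min_le_right _ _)) (hμ ▸ min_le_right _ _)
end

section
/- Nesterov-acceleration excitation-transfer bound: suppose 0 < β < 1, 0 < γ ≤ β(2−β)/(8+β²), the regressor is PE with level ε over window ΔT, ‖φ_k‖ ≤ Φ for all k, η > 0 satisfies γη(1−β) < ε₂ with ε₂ = ε/√(1+Φ²), and k ≥ ΔT. If W₁ ≤ η‖ϑ_{k−ΔT} − θ*‖, then W₂ ≥ (ΔT/(1+γΔT))·(ε₂ − γη(1−β))·‖ϑ_{k−ΔT} − θ*‖ ≥ 0. -/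
open scoped RealInnerProductSpace

theorem norm_div_sqrt_one_add_sq_le_one {E : Type*} [SeminormedAddCommGroup E] (x : E) :
    (1 / Real.sqrt (1 + ‖x‖ ^ 2)) * ‖x‖ ≤ 1 := by
  rw [one_div_mul_eq_div, div_le_one (by positivity)]
  exact Real.le_sqrt_of_sq_le (by linarith)

section InnerProduct

variable {E : Type*} [NormedAddCommGroup E] [InnerProductSpace ℝ E]

theorem abs_inner_div_sqrt_one_add_sq_le (x w : E) :
    (1 / Real.sqrt (1 + ‖x‖ ^ 2)) * |⟪x, w⟫| ≤ ‖w‖ := by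
  calc (1 / Real.sqrt (1 + ‖x‖ ^ 2)) * |⟪x, w⟫|
      ≤ (1 / Real.sqrt (1 + ‖x‖ ^ 2)) * (‖x‖ * ‖w‖) := by
        gcongr
        exact abs_real_inner_le_norm x w
    _ = ((1 / Real.sqrt (1 + ‖x‖ ^ 2)) * ‖x‖) * ‖w‖ := by ring
    _ ≤ 1 * ‖w‖ := by
        gcongr
        exact norm_div_sqrt_one_add_sq_le_one x
    _ = ‖w‖ := one_mul _

theorem norm_normalized_gradient_le {γ : ℝ} (hγ : 0 ≤ γ) (x w : E) :
    ‖((γ / (1 + ‖x‖ ^ 2)) * ⟪x, w⟫) • x‖ ≤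
      γ * ((1 / Real.sqrt (1 + ‖x‖ ^ 2)) * |⟪x, w⟫|) := by
  have hs : 1 / (1 + ‖x‖ ^ 2) =
      (1 / Real.sqrt (1 + ‖x‖ ^ 2)) * (1 / Real.sqrt (1 + ‖x‖ ^ 2)) := by
    rw [div_mul_div_comm, one_mul, Real.mul_self_sqrt (by positivity)]
  rw [norm_smul, Real.norm_eq_abs, abs_mul, abs_of_nonneg (by positivity : 0 ≤ γ / (1 + ‖x‖ ^ 2))]
  calc γ / (1 + ‖x‖ ^ 2) * |⟪x, w⟫| * ‖x‖
      = γ * ((1 / Real.sqrt (1 + ‖x‖ ^ 2)) * |⟪x, w⟫|) *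
          ((1 / Real.sqrt (1 + ‖x‖ ^ 2)) * ‖x‖) := by
        rw [div_eq_mul_one_div γ, hs]
        ring
    _ ≤ γ * ((1 / Real.sqrt (1 + ‖x‖ ^ 2)) * |⟪x, w⟫|) * 1 := by
        gcongr
        exact norm_div_sqrt_one_add_sq_le_one x
    _ = _ := mul_one _

/-- A persistence-of-excitation lower bound on unit vectors extends to all vectors. -/
theorem mul_norm_le_sum_abs_inner {ι : Type*} (s : Finset ι) (φ : ι → E) {c : ℝ}
    (h : ∀ w : E, ‖w‖ = 1 → c ≤ ∑ i ∈ s, |⟪φ i, w⟫|) (v : E) :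
    c * ‖v‖ ≤ ∑ i ∈ s, |⟪φ i, v⟫| := by
  rcases eq_or_ne v 0 with rfl | hv
  · simp
  have hv' : 0 < ‖v‖ := norm_pos_iff.mpr hv
  have h1 := h (‖v‖⁻¹ • v) (norm_smul_inv_norm (𝕜 := ℝ) hv)
  simp only [real_inner_smul_right, abs_mul, abs_of_pos (inv_pos.mpr hv')] at h1
  rw [← Finset.mul_sum, inv_mul_eq_div, le_div_iff₀ hv'] at h1
  exact h1

end InnerProduct

/-- The displacement of a sequence inside a window is at most the sum of its step bounds. -/
theorem norm_sub_le_sum_Ico_of_step {E : Type*} [SeminormedAddCommGroup E] {u : ℕ → E}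
    {b : ℕ → ℝ} (hu : ∀ i, ‖u (i + 1) - u i‖ ≤ b i) {s i k : ℕ} (hsi : s ≤ i) (hik : i ≤ k) :
    ‖u i - u s‖ ≤ ∑ j ∈ Finset.Ico s k, b j := by
  calc ‖u i - u s‖ = dist (u s) (u i) := (dist_eq_norm' _ _).symm
    _ ≤ ∑ j ∈ Finset.Ico s i, b j :=
        dist_le_Ico_sum_of_dist_le hsi fun {j} _ _ => by
          rw [dist_eq_norm']
          exact hu j
    _ ≤ ∑ j ∈ Finset.Ico s k, b j :=
        Finset.sum_le_sum_of_subset_of_nonneg (Finset.Ico_subset_Ico_right hik)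
          fun j _ _ => (norm_nonneg _).trans (hu j)

theorem na_excitation_transfer
    (n : ℕ) (hn : 1 ≤ n)
    (θstar : EuclideanSpace ℝ (Fin n))
    (φ θ ϑ θbar : ℕ → EuclideanSpace ℝ (Fin n))
    (β γ : ℝ) (hβ0 : 0 < β) (hβ1 : β < 1)
    (hγ0 : 0 < γ) (hγ : γ ≤ β * (2 - β) / (8 + β ^ 2))
    (hθbar : ∀ k, θbar k =
      θ k - ((γ * β / (1 + ‖φ k‖ ^ 2)) * ⟪φ k, θ k - θstar⟫) • φ k)
    (hθ : ∀ k, θ (k + 1) = θbar k - β • (θbar k - ϑ k))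
    (hϑ : ∀ k, ϑ (k + 1) =
      ϑ k - ((γ / (1 + ‖φ k‖ ^ 2)) * ⟪φ k, θ (k + 1) - θstar⟫) • φ k)
    (ΔT : ℕ) (hΔT : 1 ≤ ΔT) (k : ℕ) (hk : ΔT ≤ k)
    (W₁ W₂ : ℝ)
    (hW₁ : W₁ = ∑ i ∈ Finset.Ico (k - ΔT) k, ‖θbar i - ϑ i‖)
    (hW₂ : W₂ = ∑ i ∈ Finset.Ico (k - ΔT) k,
      (1 / Real.sqrt (1 + ‖φ i‖ ^ 2)) * |⟪φ i, ϑ i - θstar⟫|)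
    (ε : ℝ) (hε : 0 < ε)
    (hPE : ∀ m, ΔT ≤ m → ∀ w : EuclideanSpace ℝ (Fin n), ‖w‖ = 1 →
      ε ≤ (1 / (ΔT : ℝ)) * ∑ i ∈ Finset.Ico (m - ΔT) m, |⟪φ i, w⟫|)
    (Φ : ℝ) (hΦ : ∀ m, ‖φ m‖ ≤ Φ)
    (η : ℝ) (hη : 0 < η)
    (hηε : γ * η * (1 - β) < ε / Real.sqrt (1 + Φ ^ 2))
    (hW1 : W₁ ≤ η * ‖ϑ (k - ΔT) - θstar‖) :
    ((ΔT : ℝ) / (1 + γ * ΔT)) * (ε / Real.sqrt (1 + Φ ^ 2) - γ * η * (1 - β)) *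
        ‖ϑ (k - ΔT) - θstar‖ ≤ W₂ ∧
    0 ≤ ((ΔT : ℝ) / (1 + γ * ΔT)) * (ε / Real.sqrt (1 + Φ ^ 2) - γ * η * (1 - β)) *
        ‖ϑ (k - ΔT) - θstar‖ := by
  have hT : (0 : ℝ) < ΔT := by exact_mod_cast hΔT
  have hden : 0 < 1 + γ * ΔT := by positivity
  have hstep : ∀ i, ‖ϑ (i + 1) - ϑ i‖ ≤ γ * (1 - β) * ‖θbar i - ϑ i‖ +
      γ * ((1 / Real.sqrt (1 + ‖φ i‖ ^ 2)) * |⟪φ i, ϑ i - θstar⟫|) := by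
    intro i
    have herr : θ (i + 1) - θstar = (1 - β) • (θbar i - ϑ i) + (ϑ i - θstar) := by
      rw [hθ i]
      module
    rw [hϑ i, sub_sub_cancel_left, norm_neg]
    refine (norm_normalized_gradient_le hγ0.le _ _).trans ?_
    rw [herr, inner_add_right, real_inner_smul_right, mul_assoc, ← mul_add]
    gcongr
    have habs := abs_add_le ((1 - β) * ⟪φ i, θbar i - ϑ i⟫) ⟪φ i, ϑ i - θstar⟫
    rw [abs_mul, abs_of_pos (sub_pos.mpr hβ1)] at habs
    calc (1 / Real.sqrt (1 + ‖φ i‖ ^ 2)) *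
          |(1 - β) * ⟪φ i, θbar i - ϑ i⟫ + ⟪φ i, ϑ i - θstar⟫|
        ≤ (1 / Real.sqrt (1 + ‖φ i‖ ^ 2)) *
          ((1 - β) * |⟪φ i, θbar i - ϑ i⟫| + |⟪φ i, ϑ i - θstar⟫|) := by gcongr
      _ = (1 - β) * ((1 / Real.sqrt (1 + ‖φ i‖ ^ 2)) * |⟪φ i, θbar i - ϑ i⟫|) +
          (1 / Real.sqrt (1 + ‖φ i‖ ^ 2)) * |⟪φ i, ϑ i - θstar⟫| := by ring
      _ ≤ _ := by
          have := mul_le_mul_of_nonneg_left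
            (abs_inner_div_sqrt_one_add_sq_le (φ i) (θbar i - ϑ i)) (sub_pos.mpr hβ1).le
          linarith
  set s := k - ΔT with hs
  set v := ϑ s - θstar with hv
  have hdrift : ∀ i ∈ Finset.Ico s k, ‖ϑ i - ϑ s‖ ≤ γ * (1 - β) * W₁ + γ * W₂ := by
    intro i hi
    rw [Finset.mem_Ico] at hi
    have h := norm_sub_le_sum_Ico_of_step hstep hi.1 hi.2.le
    rwa [Finset.sum_add_distrib, ← Finset.mul_sum, ← Finset.mul_sum, ← hW₁, ← hW₂] at h
  have hexc : ε * ΔT * ‖v‖ ≤ ∑ i ∈ Finset.Ico s k, |⟪φ i, v⟫| := by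
    refine mul_norm_le_sum_abs_inner _ φ (fun w hw => ?_) v
    have h := hPE k hk w hw
    rwa [one_div_mul_eq_div, le_div_iff₀ hT] at h
  have hterm : ∀ i ∈ Finset.Ico s k, (1 / Real.sqrt (1 + Φ ^ 2)) * |⟪φ i, v⟫| ≤
      (1 / Real.sqrt (1 + ‖φ i‖ ^ 2)) * |⟪φ i, ϑ i - θstar⟫| +
        (γ * (1 - β) * W₁ + γ * W₂) := by
    intro i hi
    have hsplit : |⟪φ i, v⟫| ≤ |⟪φ i, ϑ i - θstar⟫| + |⟪φ i, ϑ i - ϑ s⟫| := by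
      have hveq : v = (ϑ i - θstar) - (ϑ i - ϑ s) := by
        rw [hv]
        abel
      rw [hveq, inner_sub_right]
      exact abs_sub _ _
    calc (1 / Real.sqrt (1 + Φ ^ 2)) * |⟪φ i, v⟫|
        ≤ (1 / Real.sqrt (1 + ‖φ i‖ ^ 2)) * |⟪φ i, v⟫| := by
          gcongr
          exact hΦ i
      _ ≤ (1 / Real.sqrt (1 + ‖φ i‖ ^ 2)) *
          (|⟪φ i, ϑ i - θstar⟫| + |⟪φ i, ϑ i - ϑ s⟫|) := by gcongr
      _ ≤ _ := by
          rw [mul_add]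
          gcongr
          exact (abs_inner_div_sqrt_one_add_sq_le _ _).trans (hdrift i hi)
  have hsum := Finset.sum_le_sum hterm
  rw [← Finset.mul_sum, Finset.sum_add_distrib, ← hW₂, Finset.sum_const, Nat.card_Ico,
    hs, Nat.sub_sub_self hk, ← hs, nsmul_eq_mul] at hsum
  have hlow : ΔT * (ε / Real.sqrt (1 + Φ ^ 2)) * ‖v‖ ≤
      W₂ + ΔT * (γ * (1 - β) * W₁ + γ * W₂) := by
    refine le_trans ?_ hsum
    calc ΔT * (ε / Real.sqrt (1 + Φ ^ 2)) * ‖v‖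
        = (1 / Real.sqrt (1 + Φ ^ 2)) * (ε * ΔT * ‖v‖) := by ring
      _ ≤ _ := by gcongr
  have hW1' : ΔT * (γ * (1 - β)) * W₁ ≤ ΔT * (γ * (1 - β)) * (η * ‖v‖) :=
    mul_le_mul_of_nonneg_left hW1
      (mul_nonneg hT.le (mul_nonneg hγ0.le (sub_pos.mpr hβ1).le))
  constructor
  · rw [div_mul_eq_mul_div, div_mul_eq_mul_div, div_le_iff₀ hden]
    linarith
  · exact mul_nonneg (mul_nonneg (by positivity) (sub_pos.mpr hηε).le) (norm_nonneg _)
end
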